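/- Let p and N be two distinct prime numbers. Then Σ_{χ ∈ D₋(N)} χ(p)/τ(χ) = −i · ((N−1)/N) · sin(2πp/N). -/

import Mathlib

open Finset

/-- The Gauss sum `τ(χ) = Σ_{b=1}^{N} χ(b) e^{2πib/N}`. -/
noncomputable def gaussSum' {N : ℕ} (χ : DirichletCharacter ℂ N) : ℂ :=
  ∑ b ∈ Finset.Icc 1 N,
    χ ((b : ℕ) : ZMod N) * Complex.exp (2 * Real.pi * Complex.I * (b : ℂ) / (N : ℂ))

lemma gaussSum'_eq_gaussSum {N : ℕ} [NeZero N] (χ : DirichletCharacter ℂ N) :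
    gaussSum' χ = gaussSum χ ZMod.stdAddChar := by
  refine Finset.sum_bij (fun b _ => (b : ZMod N)) (fun _ _ => Finset.mem_univ _) ?_ ?_ ?_
  · intro a ha b hb hab
    rw [Finset.mem_Icc] at ha hb
    rw [ZMod.natCast_eq_natCast_iff] at hab
    refine hab.eq_of_abs_lt (abs_sub_lt_iff.mpr ⟨?_, ?_⟩) <;> omega
  · intro x _
    rcases eq_or_ne x 0 with rfl | hx
    · exact ⟨N, by simp [NeZero.one_le], by simp⟩
    · refine ⟨x.val, Finset.mem_Icc.mpr ⟨?_, x.val_lt.le⟩, ZMod.natCast_zmod_val x⟩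
      exact Nat.one_le_iff_ne_zero.mpr fun h => hx ((ZMod.val_eq_zero x).mp h)
  · intro b _
    have h := ZMod.stdAddChar_coe (N := N) (b : ℤ)
    push_cast at h
    rw [h]

/-- Fourier inversion on the multiplicative group of a prime field. -/
lemma sum_char_mul_gaussSum_inv {N : ℕ} [Fact N.Prime] (ψ : AddChar (ZMod N) ℂ)
    {c : ZMod N} (hc : c ≠ 0) :
    ∑ χ : DirichletCharacter ℂ N, χ c * gaussSum χ⁻¹ ψ = ((N : ℂ) - 1) * ψ c := by
  have key (a : ZMod N) : ∑ χ : DirichletCharacter ℂ N, χ c * (χ⁻¹ a * ψ a) =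
      if c = a then ((N : ℂ) - 1) * ψ a else 0 := by
    simp_rw [MulChar.inv_apply', ← mul_assoc, ← map_mul, ← Finset.sum_mul,
      DirichletCharacter.sum_characters_eq, Nat.totient_prime (Fact.out : N.Prime),
      Nat.cast_sub (Fact.out : N.Prime).one_le, Nat.cast_one]
    have : c * a⁻¹ = 1 ↔ c = a := by
      rcases eq_or_ne a 0 with rfl | ha
      · simp [hc]
      · exact mul_inv_eq_one₀ ha
    simp only [this, ite_mul, zero_mul]
  simp_rw [gaussSum, Finset.mul_sum]
  rw [Finset.sum_comm]
  simp [key]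

lemma ne_one_of_odd {N : ℕ} {χ : DirichletCharacter ℂ N} (hχ : χ.Odd) : χ ≠ 1 := by
  rintro rfl
  rw [DirichletCharacter.Odd, MulChar.one_apply isUnit_one.neg] at hχ
  norm_num at hχ

lemma isPrimitive_of_odd {N : ℕ} [Fact N.Prime] {χ : DirichletCharacter ℂ N} (hχ : χ.Odd) :
    χ.IsPrimitive := by
  rcases (Nat.dvd_prime (Fact.out : N.Prime)).mp χ.conductor_dvd_level with h | h
  · exact absurd (χ.eq_one_iff_conductor_eq_one.mpr h) (ne_one_of_odd hχ)
  · exact h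

open scoped Classical in
lemma ite_odd_div_gaussSum {N : ℕ} [Fact N.Prime] (χ : DirichletCharacter ℂ N) (c : ZMod N) :
    (if χ.Odd then χ c / gaussSum χ ZMod.stdAddChar else 0) =
      (χ (-c) * gaussSum χ⁻¹ ZMod.stdAddChar - χ c * gaussSum χ⁻¹ ZMod.stdAddChar) /
        (2 * (N : ℂ)) := by
  have hN : (N : ℂ) ≠ 0 := Nat.cast_ne_zero.mpr (Fact.out : N.Prime).ne_zero
  split_ifs with hodd
  · have hmul := gaussSum_mul_gaussSum_eq_card (ne_one_of_odd hodd) (ZMod.isPrimitive_stdAddChar N)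
    have hinv := mul_gaussSum_inv_eq_gaussSum χ⁻¹ (ZMod.stdAddChar (N := N))
    have hneg : χ⁻¹ (-1) = -1 := by rw [MulChar.inv_apply', inv_neg_one]; exact hodd
    rw [hneg] at hinv
    rw [ZMod.card] at hmul
    have hτ : gaussSum χ ZMod.stdAddChar ≠ 0 := left_ne_zero_of_mul (hmul ▸ hN)
    rw [hodd.eval_neg, ← hinv]
    field_simp
    linear_combination -2 * χ c * hmul
  · rw [(χ.even_or_odd.resolve_right hodd).eval_neg, sub_self, zero_div]

theorem odd_primitive_character_sum (p N : ℕ) (hp : p.Prime) (hN : N.Prime)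
    (hpN : p ≠ N) :
    ∑ᶠ χ ∈ {χ : DirichletCharacter ℂ N | χ.IsPrimitive ∧ χ (-1) = -1},
        χ ((p : ℕ) : ZMod N) / gaussSum' χ
      = -Complex.I *
          Complex.ofReal ((((N : ℝ) - 1) / N) * Real.sin (2 * Real.pi * p / N)) := by
  classical
  have : Fact N.Prime := ⟨hN⟩
  have hc : (p : ZMod N) ≠ 0 := fun h =>
    hpN ((Nat.prime_dvd_prime_iff_eq hN hp).mp ((ZMod.natCast_eq_zero_iff p N).mp h)).symm
  have hterm (χ : DirichletCharacter ℂ N) :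
      (∑ᶠ _ : χ ∈ {χ : DirichletCharacter ℂ N | χ.IsPrimitive ∧ χ (-1) = -1},
        χ ((p : ℕ) : ZMod N) / gaussSum' χ) =
      if χ.Odd then χ p / gaussSum χ ZMod.stdAddChar else 0 := by
    rw [finsum_eq_if, gaussSum'_eq_gaussSum]
    exact if_congr ⟨fun h => h.2, fun h => ⟨isPrimitive_of_odd h, h⟩⟩ rfl rfl
  rw [finsum_congr hterm, finsum_eq_sum_of_fintype]
  simp_rw [ite_odd_div_gaussSum]
  rw [← Finset.sum_div, Finset.sum_sub_distrib, sum_char_mul_gaussSum_inv _ (neg_ne_zero.mpr hc),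
    sum_char_mul_gaussSum_inv _ hc]
  have hpos := ZMod.stdAddChar_coe (N := N) (p : ℤ)
  have hneg := ZMod.stdAddChar_coe (N := N) (-p : ℤ)
  push_cast at hpos hneg
  rw [hpos, hneg]
  push_cast
  rw [Complex.sin,
    show 2 * (Real.pi : ℂ) * Complex.I * p / N = 2 * Real.pi * p / N * Complex.I by ring,
    show 2 * (Real.pi : ℂ) * Complex.I * -p / N = -(2 * Real.pi * p / N) * Complex.I by ring]
  linear_combination (((N : ℂ) - 1) / (2 * N) *
    (Complex.exp (-(2 * Real.pi * p / N) * Complex.I) -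
      Complex.exp (2 * Real.pi * p / N * Complex.I))) * Complex.I_sq
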